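/- Concrete composition correctness: for any two concrete labeled transition systems M and N, the set of traces of their CSP-style asynchronous parallel composition equals the partially synchronized interleaving of their trace sets: Traces(M ‖ N) = Traces(M) ⊗ Traces(N). -/

import Mathlib

/-- A labeled transition system: a set of (relevant) events, an initial state,
and a transition relation. -/
structure LTS (State : Type*) (Ev : Type*) where
  events : Set Ev
  init : State
  step : State → Ev → State → Prop

namespace LTS

/-- Executions of an LTS from a state, accumulating the emitted events. -/
inductive Exec {State Ev : Type*} (M : LTS State Ev) : State → List Ev → State → Prop
  | nil (s : State) : Exec M s [] s
  | cons {s s' s'' : State} {e : Ev} {tr : List Ev} :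
      M.step s e s' → Exec M s' tr s'' → Exec M s (e :: tr) s''

/-- The set of (finite) traces of an LTS. -/
def Traces {State Ev : Type*} (M : LTS State Ev) : Set (List Ev) :=
  { tr | ∃ s, M.Exec M.init tr s }

end LTS

/-- A symbolic LTS: an LTS whose states consist of a symbol set, a predicate
set, and an inner state, together with a deduction relation such that every
deducible predicate can be added to the predicate set by a silent `tau` step. -/
structure SymLTS (ℰ C Ev P : Type*) where
  toLTS : LTS (Set ℰ × Set P × C) Ev
  tau : Ev
  ded : Set P → P → Prop
  ded_step : ∀ (Sy : Set ℰ) (Ps : Set P) (φ : P) (c : C),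
      ded Ps φ → toLTS.step (Sy, Ps, c) tau (Sy, insert φ Ps, c)

namespace SymLTS

def events {ℰ C Ev P : Type*} (S : SymLTS ℰ C Ev P) : Set Ev := S.toLTS.events

def Traces {ℰ C Ev P : Type*} (S : SymLTS ℰ C Ev P) : Set (List Ev) := S.toLTS.Traces

end SymLTS

/-- Projection of a combined predicate set to the first component. -/
def projl {P₁ P₂ : Type*} (Ps : Set (P₁ ⊕ P₂)) : Set P₁ := { p | Sum.inl p ∈ Ps }

/-- Projection of a combined predicate set to the second component. -/
def projr {P₁ P₂ : Type*} (Ps : Set (P₁ ⊕ P₂)) : Set P₂ := { p | Sum.inr p ∈ Ps }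

/-- The transition relation of the symbolic parallel composition of two
symbolic LTS over the same symbol space, parametric in a combined deduction
relation `dded` and a silent event `tau`. -/
inductive CompStep {ℰ C₁ C₂ Ev P₁ P₂ : Type*}
    (S₁ : SymLTS ℰ C₁ Ev P₁) (S₂ : SymLTS ℰ C₂ Ev P₂)
    (dded : Set (P₁ ⊕ P₂) → (P₁ ⊕ P₂) → Prop) (tau : Ev) :
    (Set ℰ × Set (P₁ ⊕ P₂) × (C₁ × C₂)) → Ev →
    (Set ℰ × Set (P₁ ⊕ P₂) × (C₁ × C₂)) → Prop
  | left {Sy Sy' : Set ℰ} {Ps Ps' : Set (P₁ ⊕ P₂)} {c₁ c₁' : C₁} {c₂ : C₂} {α : Ev} :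
      α ∈ S₁.events → α ∉ S₂.events →
      S₁.toLTS.step (Sy, projl Ps, c₁) α (Sy', projl Ps', c₁') →
      projr Ps = projr Ps' →
      CompStep S₁ S₂ dded tau (Sy, Ps, (c₁, c₂)) α (Sy', Ps', (c₁', c₂))
  | right {Sy Sy' : Set ℰ} {Ps Ps' : Set (P₁ ⊕ P₂)} {c₁ : C₁} {c₂ c₂' : C₂} {α : Ev} :
      α ∈ S₂.events → α ∉ S₁.events →
      S₂.toLTS.step (Sy, projr Ps, c₂) α (Sy', projr Ps', c₂') →
      projl Ps = projl Ps' →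
      CompStep S₁ S₂ dded tau (Sy, Ps, (c₁, c₂)) α (Sy', Ps', (c₁, c₂'))
  | sync {Sy Sy₁' Sy₂' : Set ℰ} {Ps Ps' : Set (P₁ ⊕ P₂)} {c₁ c₁' : C₁} {c₂ c₂' : C₂} {α : Ev} :
      α ∈ S₁.events → α ∈ S₂.events →
      S₁.toLTS.step (Sy, projl Ps, c₁) α (Sy₁', projl Ps', c₁') →
      S₂.toLTS.step (Sy, projr Ps, c₂) α (Sy₂', projr Ps', c₂') →
      CompStep S₁ S₂ dded tau (Sy, Ps, (c₁, c₂)) α (Sy₁' ∪ Sy₂', Ps', (c₁', c₂'))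
  | ded {Sy : Set ℰ} {Ps : Set (P₁ ⊕ P₂)} {π : P₁ ⊕ P₂} {c₁ : C₁} {c₂ : C₂} :
      dded Ps π →
      CompStep S₁ S₂ dded tau (Sy, Ps, (c₁, c₂)) tau (Sy, insert π Ps, (c₁, c₂))

/-- Symbolic parallel composition of two symbolic LTS over the same symbol
space, parametric in a combined deduction relation. -/
def SymParComp {ℰ C₁ C₂ Ev P₁ P₂ : Type*}
    (S₁ : SymLTS ℰ C₁ Ev P₁) (S₂ : SymLTS ℰ C₂ Ev P₂)
    (dded : Set (P₁ ⊕ P₂) → (P₁ ⊕ P₂) → Prop) (tau : Ev) :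
    SymLTS ℰ (C₁ × C₂) Ev (P₁ ⊕ P₂) where
  toLTS :=
    { events := S₁.events ∪ S₂.events
      init := (S₁.toLTS.init.1 ∪ S₂.toLTS.init.1,
               Sum.inl '' S₁.toLTS.init.2.1 ∪ Sum.inr '' S₂.toLTS.init.2.1,
               (S₁.toLTS.init.2.2, S₂.toLTS.init.2.2))
      step := CompStep S₁ S₂ dded tau }
  tau := tau
  ded := dded
  ded_step := fun _Sy _Ps φ c h => by
    obtain ⟨a, b⟩ := c
    exact CompStep.ded h

/-- The empty combined deduction relation: it derives no predicates. -/
def emptyDed {Q : Type*} : Set Q → Q → Prop := fun _ _ => False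

/-- A combined deduction relation is *enabling* (w.r.t. the composition of
`S₁` and `S₂`) if adding any predicate it derives never disables a transition
of the composed system. -/
def Enabling {ℰ C₁ C₂ Ev P₁ P₂ : Type*}
    (S₁ : SymLTS ℰ C₁ Ev P₁) (S₂ : SymLTS ℰ C₂ Ev P₂)
    (dded : Set (P₁ ⊕ P₂) → (P₁ ⊕ P₂) → Prop) (tau : Ev) : Prop :=
  ∀ (Ps : Set (P₁ ⊕ P₂)) (π : P₁ ⊕ P₂), dded Ps π →
    ∀ (Sy Sy' : Set ℰ) (Ps' : Set (P₁ ⊕ P₂)) (c c' : C₁ × C₂) (α : Ev),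
      CompStep S₁ S₂ dded tau (Sy, Ps, c) α (Sy', Ps', c') →
      CompStep S₁ S₂ dded tau (Sy, insert π Ps, c) α (Sy', insert π Ps', c')

/-- A combined deduction relation is *disabling* (w.r.t. the composition of
`S₁` and `S₂`) if adding any predicate it derives never enables a new
transition of the composed system. -/
def Disabling {ℰ C₁ C₂ Ev P₁ P₂ : Type*}
    (S₁ : SymLTS ℰ C₁ Ev P₁) (S₂ : SymLTS ℰ C₂ Ev P₂)
    (dded : Set (P₁ ⊕ P₂) → (P₁ ⊕ P₂) → Prop) (tau : Ev) : Prop :=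
  ∀ (Ps : Set (P₁ ⊕ P₂)) (π : P₁ ⊕ P₂), dded Ps π →
    ∀ (Sy Sy' : Set ℰ) (Ps' : Set (P₁ ⊕ P₂)) (c c' : C₁ × C₂) (α : Ev),
      CompStep S₁ S₂ dded tau (Sy, insert π Ps, c) α (Sy', insert π Ps', c') →
      CompStep S₁ S₂ dded tau (Sy, Ps, c) α (Sy', Ps', c')

/-- Partially synchronized interleaving of two traces: events in `Sync`
(synchronizing events) must be taken jointly as a single occurrence, all other
events are interleaved preserving the relative order within each trace. -/
inductive Interleave {Ev : Type*} (Sync : Set Ev) : List Ev → List Ev → List Ev → Prop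
  | nil : Interleave Sync [] [] []
  | left {e : Ev} {t₁ t₂ t : List Ev} :
      e ∉ Sync → Interleave Sync t₁ t₂ t → Interleave Sync (e :: t₁) t₂ (e :: t)
  | right {e : Ev} {t₁ t₂ t : List Ev} :
      e ∉ Sync → Interleave Sync t₁ t₂ t → Interleave Sync t₁ (e :: t₂) (e :: t)
  | sync {e : Ev} {t₁ t₂ t : List Ev} :
      e ∈ Sync → Interleave Sync t₁ t₂ t → Interleave Sync (e :: t₁) (e :: t₂) (e :: t)

/-- Partially synchronized interleaving of two trace sets. -/
def interleaving {Ev : Type*} (Sync : Set Ev) (T₁ T₂ : Set (List Ev)) : Set (List Ev) :=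
  { t | ∃ t₁ ∈ T₁, ∃ t₂ ∈ T₂, Interleave Sync t₁ t₂ t }

/-- CSP-style asynchronous parallel composition of two concrete LTS: events in
the intersection of the event sets synchronize, all other events are taken
asynchronously by one component while the other stays. -/
def ConcComp {SM SN Ev : Type*} (M : LTS SM Ev) (N : LTS SN Ev) : LTS (SM × SN) Ev where
  events := M.events ∪ N.events
  init := (M.init, N.init)
  step := fun s α s' =>
    (α ∈ M.events ∧ α ∈ N.events ∧ M.step s.1 α s'.1 ∧ N.step s.2 α s'.2) ∨
    (¬(α ∈ M.events ∧ α ∈ N.events) ∧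
      ((M.step s.1 α s'.1 ∧ s'.2 = s.2) ∨ (N.step s.2 α s'.2 ∧ s'.1 = s.1)))

/-- Projection of a trace to the events of one component. -/
noncomputable def projTrace {Ev : Type*} (E : Set Ev) (t : List Ev) : List Ev :=
  t.filter (fun e => @decide (e ∈ E) (Classical.propDecidable _))


/-- Every execution of the composition splits into executions of the components whose traces
interleave to the given trace. -/
theorem LTS.Exec.exists_interleave {SM SN Ev : Type*} {M : LTS SM Ev} {N : LTS SN Ev}
    {p q : SM × SN} {t : List Ev} (h : (ConcComp M N).Exec p t q) :
    ∃ t₁ t₂, M.Exec p.1 t₁ q.1 ∧ N.Exec p.2 t₂ q.2 ∧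
      Interleave (M.events ∩ N.events) t₁ t₂ t := by
  induction h with
  | nil s => exact ⟨[], [], .nil _, .nil _, .nil⟩
  | cons hstep _ ih =>
    obtain ⟨t₁, t₂, hM, hN, hi⟩ := ih
    rcases hstep with ⟨heM, heN, hsM, hsN⟩ | ⟨he, ⟨hsM, heq⟩ | ⟨hsN, heq⟩⟩
    · exact ⟨_, _, .cons hsM hM, .cons hsN hN, .sync ⟨heM, heN⟩ hi⟩
    · exact ⟨_, _, .cons hsM hM, heq ▸ hN, .left he hi⟩
    · exact ⟨_, _, heq ▸ hM, .cons hsN hN, .right he hi⟩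

/-- Executions of the components combine into an execution of the composition along any
interleaving of their traces. -/
theorem Interleave.exec_concComp {SM SN Ev : Type*} {M : LTS SM Ev} {N : LTS SN Ev}
    {t₁ t₂ t : List Ev} (h : Interleave (M.events ∩ N.events) t₁ t₂ t)
    {m m' : SM} {n n' : SN} (hM : M.Exec m t₁ m') (hN : N.Exec n t₂ n') :
    (ConcComp M N).Exec (m, n) t (m', n') := by
  induction h generalizing m n with
  | nil =>
    cases hM
    cases hN
    exact .nil _
  | left he _ ih =>
    cases hM with
    | cons hsM hM => exact .cons (s' := (_, n)) (.inr ⟨he, .inl ⟨hsM, rfl⟩⟩) (ih hM hN)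
  | right he _ ih =>
    cases hN with
    | cons hsN hN => exact .cons (s' := (m, _)) (.inr ⟨he, .inr ⟨hsN, rfl⟩⟩) (ih hM hN)
  | sync he _ ih =>
    cases hM with
    | cons hsM hM =>
      cases hN with
      | cons hsN hN => exact .cons (.inl ⟨he.1, he.2, hsM, hsN⟩) (ih hM hN)

/-- **Concrete composition correctness:** the traces of the CSP-style
asynchronous parallel composition of two concrete LTS are exactly the
partially synchronized interleaving of their trace sets. -/
theorem concrete_composition_correctness
    {SM SN Ev : Type*} (M : LTS SM Ev) (N : LTS SN Ev) :
    (ConcComp M N).Traces = interleaving (M.events ∩ N.events) M.Traces N.Traces := by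
  ext t
  constructor
  · rintro ⟨q, h⟩
    obtain ⟨t₁, t₂, hM, hN, hi⟩ := h.exists_interleave
    exact ⟨t₁, ⟨_, hM⟩, t₂, ⟨_, hN⟩, hi⟩
  · rintro ⟨t₁, ⟨m, hM⟩, t₂, ⟨n, hN⟩, hi⟩
    exact ⟨(m, n), hi.exec_concComp hM hN⟩
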